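/- arXiv:1701.07219 — 10 statements merged into one kernel-verified Lean document; each statement's English description precedes it below -/
import Mathlib

section
/- Let K be a field, let P be a 3×3 generalized permutation matrix over K (so P is invertible), and let M be any 3×3 matrix over K. Then the number of zero entries on the main diagonal of P⁻¹ M P^{(2)} equals the number of zero entries on the main diagonal of M, where P^{(2)} is the entrywise square of P. -/
/-- A generalized permutation matrix: exactly one nonzero entry in each row and each
column. -/
def IsGenPermMatrix {K : Type*} [Field K] (P : Matrix (Fin 3) (Fin 3) K) : Prop :=
  (∀ i, ∃! j, P i j ≠ 0) ∧ (∀ j, ∃! i, P i j ≠ 0)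

/-- The inverse of a generalized permutation matrix is the transpose of its entrywise inverse. -/
theorem IsGenPermMatrix.inv_eq {K : Type*} [Field K] {P : Matrix (Fin 3) (Fin 3) K}
    (hP : IsGenPermMatrix P) : P⁻¹ = (P.map (fun x => x⁻¹)).transpose := by
  apply Matrix.inv_eq_left_inv
  ext j k
  obtain ⟨a, ha, hcol⟩ := hP.2 j
  rw [Matrix.mul_apply, Finset.sum_eq_single a]
  · by_cases hjk : j = k
    · subst hjk
      simp [ha]
    · have : P a k = 0 := by
        by_contra h
        exact hjk ((hP.1 a).unique ha h)
      simp [this, hjk]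
  · intro b _ hb
    have : P b j = 0 := by
      by_contra h
      exact hb (hcol b h)
    simp [this]
  · simp

/-- The diagonal entries of `P⁻¹ * M * P^{(2)}` are rescaled diagonal entries of `M`. -/
theorem IsGenPermMatrix.inv_mul_mul_map_sq_apply_self {K : Type*} [Field K]
    {P : Matrix (Fin 3) (Fin 3) K} (hP : IsGenPermMatrix P) (M : Matrix (Fin 3) (Fin 3) K)
    {a j : Fin 3} (ha : P a j ≠ 0) :
    (P⁻¹ * M * P.map (fun x => x ^ 2)) j j = P a j * M a a := by
  have hzero : ∀ b, b ≠ a → P b j = 0 := by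
    intro b hb
    by_contra h
    exact hb ((hP.2 j).unique h ha)
  rw [hP.inv_eq, Matrix.mul_apply, Finset.sum_eq_single a, Matrix.mul_apply,
    Finset.sum_eq_single a]
  · simp only [Matrix.transpose_apply, Matrix.map_apply]
    field_simp
  · intro b _ hb
    simp [hzero b hb]
  · simp
  · intro b _ hb
    simp [hzero b hb]
  · simp

/-- If `P` is a `3 × 3` generalized permutation matrix over a field `K`
and `M` is any `3 × 3` matrix over `K`, then `P⁻¹ * M * P^{(2)}` has the same number of
zero entries on the main diagonal as `M` does. -/
theorem genPerm_action_preserves_diagonal_zero_entries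
    {K : Type*} [Field K] (P M : Matrix (Fin 3) (Fin 3) K)
    (hP : IsGenPermMatrix P) :
    {i : Fin 3 | (P⁻¹ * M * P.map (fun x => x ^ 2)) i i = 0}.ncard =
      {i : Fin 3 | M i i = 0}.ncard := by
  choose t ht using fun j => (hP.2 j).exists
  have hinj : Function.Injective t := fun j k hjk =>
    (hP.1 (t j)).unique (ht j) (by rw [hjk]; exact ht k)
  have hset : {i : Fin 3 | (P⁻¹ * M * P.map (fun x => x ^ 2)) i i = 0} =
      t ⁻¹' {i : Fin 3 | M i i = 0} := by
    ext j
    simp [hP.inv_mul_mul_map_sq_apply_self M (ht j), ht j]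
  rw [hset, Set.ncard_preimage_of_injective_subset_range hinj]
  simp [(Finite.injective_iff_surjective.mp hinj).range_eq]
end

section
/- Let K be a field and let M = (ω_{ij}) be a 3×3 matrix over K whose third column equals c₁ times the first column plus c₂ times the second column, where c₁, c₂ ∈ K with c₁ c₂ ≠ 0, and such that ω₁₁ω₂₂ − ω₁₂ω₂₁ ≠ 0. If P is an invertible 3×3 matrix over K such that M · (P_{·i} ⊙ P_{·j}) = 0 for every pair i ≠ j (where P_{·i} denotes the i-th column of P and ⊙ the componentwise product), then P is a generalized permutation matrix, i.e. P has exactly one nonzero entry in each row and each column. -/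
/-- If the Hadamard products of distinct columns of an invertible matrix are all multiples of one
vector `w` without zero entries, then they vanish, as soon as there is a third column. -/
theorem Matrix.coeff_eq_zero_of_column_mul_column_eq {n K : Type*} [Fintype n] [DecidableEq n]
    [Field K] {P : Matrix n n K} {w : n → K} {t : n → n → K} (hw : ∀ k, w k ≠ 0)
    (hdet : P.det ≠ 0) (hP : ∀ k i j, i ≠ j → P k i * P k j = w k * t i j)
    {i j l : n} (hij : i ≠ j) (hil : i ≠ l) (hjl : j ≠ l) : t i j = 0 := by
  by_contra ht
  have hne : ∀ k, P k i * P k j ≠ 0 := fun k => by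
    rw [hP k i j hij]
    exact mul_ne_zero (hw k) ht
  have hi : ∀ k, P k i ≠ 0 := fun k => left_ne_zero_of_mul (hne k)
  have hj : ∀ k, P k j ≠ 0 := fun k => right_ne_zero_of_mul (hne k)
  by_cases hl : t i l = 0
  · refine hdet (Matrix.det_eq_zero_of_column_eq_zero l fun k => ?_)
    have h := hP k i l hil
    rw [hl, mul_zero] at h
    exact (mul_eq_zero.mp h).resolve_left (hi k)
  · refine hdet (Matrix.exists_mulVec_eq_zero_iff.mp
      ⟨Pi.single i (t j l) - Pi.single j (t i l), fun h => hl ?_, ?_⟩)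
    · simpa [hij] using congrFun h j
    · ext k
      have h₁ := hP k i l hil
      have h₂ := hP k j l hjl
      have hkl : P k l ≠ 0 := right_ne_zero_of_mul (h₁ ▸ mul_ne_zero (hw k) hl)
      simp only [Matrix.mulVec_sub, Matrix.mulVec_single, Pi.sub_apply, Pi.zero_apply,
        Pi.smul_apply, Matrix.col_apply, MulOpposite.smul_eq_mul_unop, MulOpposite.unop_op]
      apply mul_right_cancel₀ hkl
      linear_combination t j l * h₁ - t i l * h₂

/-- An invertible matrix with at most one nonzero entry in each row is a generalized permutation
matrix. -/
theorem Matrix.existsUnique_ne_zero_of_row_mul_eq_zero {n K : Type*} [Fintype n] [DecidableEq n]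
    [Field K] {P : Matrix n n K} (hdet : P.det ≠ 0)
    (hP : ∀ k i j, i ≠ j → P k i * P k j = 0) :
    (∀ i, ∃! j, P i j ≠ 0) ∧ (∀ j, ∃! i, P i j ≠ 0) := by
  have hrow : ∀ i, ∃ j, P i j ≠ 0 := fun i => by
    by_contra! h
    exact hdet (Matrix.det_eq_zero_of_row_eq_zero i h)
  have hcol : ∀ j, ∃ i, P i j ≠ 0 := fun j => by
    by_contra! h
    exact hdet (Matrix.det_eq_zero_of_column_eq_zero j h)
  choose f hf using hrow
  have huniq : ∀ i j, P i j ≠ 0 → j = f i := fun i j hj => by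
    by_contra h
    exact mul_ne_zero hj (hf i) (hP i j (f i) h)
  have hinj : Function.Injective f := Finite.injective_iff_surjective.mpr fun j =>
    (hcol j).imp fun i hi => (huniq i j hi).symm
  refine ⟨fun i => ⟨f i, hf i, huniq i⟩, fun j => ?_⟩
  obtain ⟨i, hi⟩ := hcol j
  exact ⟨i, hi, fun k hk => hinj ((huniq k j hk).symm.trans (huniq i j hi))⟩

/-- Let `M` be a `3 × 3` matrix over a field `K` whose third column is
`c₁` times the first column plus `c₂` times the second, with `c₁ * c₂ ≠ 0`, and with
`M₀₀M₁₁ − M₀₁M₁₀ ≠ 0`.  If `P` is invertible and `M · (P_{·i} ⊙ P_{·j}) = 0` for all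
`i ≠ j`, then `P` is a generalized permutation matrix. -/
theorem change_of_basis_is_genPerm_of_rank_two_case1
    {K : Type*} [Field K] (M P : Matrix (Fin 3) (Fin 3) K) (c₁ c₂ : K)
    (hc : c₁ * c₂ ≠ 0)
    (hcol : ∀ i, M i 2 = c₁ * M i 0 + c₂ * M i 1)
    (hminor : M 0 0 * M 1 1 - M 0 1 * M 1 0 ≠ 0)
    (hPdet : P.det ≠ 0)
    (hP : ∀ i j, i ≠ j → M.mulVec (fun k => P k i * P k j) = 0) :
    (∀ i, ∃! j, P i j ≠ 0) ∧ (∀ j, ∃! i, P i j ≠ 0) := by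
  have hker : ∀ k i j, i ≠ j →
      P k i * P k j = (![-c₁, -c₂, 1] : Fin 3 → K) k * (P 2 i * P 2 j) := by
    intro k i j hij
    have h₀ := congrFun (hP i j hij) 0
    have h₁ := congrFun (hP i j hij) 1
    simp only [Matrix.mulVec, dotProduct, Fin.sum_univ_three, hcol, Pi.zero_apply] at h₀ h₁
    fin_cases k
    · apply mul_left_cancel₀ hminor
      simp
      linear_combination M 1 1 * h₀ - M 0 1 * h₁
    · apply mul_left_cancel₀ hminor
      simp
      linear_combination M 0 0 * h₁ - M 1 0 * h₀
    · simp
  have hw : ∀ k, (![-c₁, -c₂, 1] : Fin 3 → K) k ≠ 0 := by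
    simpa [Fin.forall_fin_succ] using hc
  refine Matrix.existsUnique_ne_zero_of_row_mul_eq_zero hPdet fun k i j hij => ?_
  obtain ⟨l, hil, hjl⟩ : ∃ l : Fin 3, i ≠ l ∧ j ≠ l := by
    revert i j
    decide
  rw [hker k i j hij,
    Matrix.coeff_eq_zero_of_column_mul_column_eq (t := fun i j => P 2 i * P 2 j)
      hw hPdet hker hij hil hjl, mul_zero]
end

section
/- Let K be a field and let M = (ω_{ij}) be a 3×3 matrix over K whose third column is zero and such that ω₁₁ω₂₂ − ω₁₂ω₂₁ ≠ 0. If P is an invertible 3×3 matrix over K such that M · (P_{·i} ⊙ P_{·j}) = 0 for every pair i ≠ j (where P_{·i} denotes the i-th column of P and ⊙ the componentwise product), then each of the first two rows of P contains exactly one nonzero entry, and the nonzero entries of the first row and of the second row of P lie in different columns. -/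
/-- A nonzero vector whose distinct entries have zero products has exactly one nonzero entry. -/
theorem existsUnique_ne_zero_of_pairwise_mul_eq_zero {ι R : Type*} [MulZeroClass R]
    [NoZeroDivisors R] {v : ι → R} (hv : v ≠ 0) (h : ∀ i j, i ≠ j → v i * v j = 0) :
    ∃! j, v j ≠ 0 := by
  obtain ⟨j, hj⟩ := Function.ne_iff.mp hv
  refine ⟨j, hj, fun k hk => ?_⟩
  by_contra hkj
  exact mul_ne_zero hk hj (h k j hkj)


/-- Let `M` be a `3 × 3` matrix over a field `K` whose third column is
zero and with `M₀₀M₁₁ − M₀₁M₁₀ ≠ 0`.  If `P` is invertible and `M · (P_{·i} ⊙ P_{·j}) = 0`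
for all `i ≠ j`, then each of the first two rows of `P` has exactly one nonzero entry,
and the nonzero entries of the first and second rows lie in different columns. -/
theorem change_of_basis_rows_of_rank_two_case4
    {K : Type*} [Field K] (M P : Matrix (Fin 3) (Fin 3) K)
    (hcol : ∀ i, M i 2 = 0)
    (hminor : M 0 0 * M 1 1 - M 0 1 * M 1 0 ≠ 0)
    (hPdet : P.det ≠ 0)
    (hP : ∀ i j, i ≠ j → M.mulVec (fun k => P k i * P k j) = 0) :
    (∃! j, P 0 j ≠ 0) ∧ (∃! j, P 1 j ≠ 0) ∧ (∀ j, P 0 j ≠ 0 → P 1 j = 0) := by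
  have prods : ∀ i j, i ≠ j → P 0 i * P 0 j = 0 ∧ P 1 i * P 1 j = 0 := by
    intro i j hij
    have e0 := congrFun (hP i j hij) 0
    have e1 := congrFun (hP i j hij) 1
    simp only [Matrix.mulVec, dotProduct, Fin.sum_univ_three, hcol, Pi.zero_apply, zero_mul,
      add_zero] at e0 e1
    constructor <;> apply mul_left_cancel₀ hminor
    · linear_combination M 1 1 * e0 - M 0 1 * e1
    · linear_combination M 0 0 * e1 - M 1 0 * e0
  have row_ne_zero : ∀ i, P i ≠ 0 := fun i hi =>
    hPdet (Matrix.det_eq_zero_of_row_eq_zero i (congrFun hi))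
  refine ⟨existsUnique_ne_zero_of_pairwise_mul_eq_zero (row_ne_zero 0) fun i j hij =>
      (prods i j hij).1,
    existsUnique_ne_zero_of_pairwise_mul_eq_zero (row_ne_zero 1) fun i j hij =>
      (prods i j hij).2, fun j h0 => ?_⟩
  by_contra h1
  have z0 : ∀ k, k ≠ j → P 0 k = 0 := fun k hk =>
    (mul_eq_zero.mp (prods k j hk).1).resolve_right h0
  have z1 : ∀ k, k ≠ j → P 1 k = 0 := fun k hk =>
    (mul_eq_zero.mp (prods k j hk).2).resolve_right h1
  apply hPdet
  rw [Matrix.det_fin_three]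
  fin_cases j
  · simp [z0 1, z0 2, z1 1, z1 2]
  · simp [z0 0, z0 2, z1 0, z1 2]
  · simp [z0 0, z0 1, z1 0, z1 1]
end

section
/- Let K be a field in which every element has a cube root and a seventh root. Let M be an invertible 3×3 matrix over K having exactly three nonzero entries. Then there exists an invertible diagonal 3×3 matrix D over K such that D⁻¹ M D^{(2)} is a permutation matrix (a matrix obtained from the identity matrix by permuting its rows), where D^{(2)} is the entrywise square of D. -/
theorem Matrix.exists_perm_forall_apply_ne_zero {n R : Type*} [Fintype n] [DecidableEq n]
    [CommRing R] {M : Matrix n n R} (hM : M.det ≠ 0) :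
    ∃ σ : Equiv.Perm n, ∀ i, M i (σ i) ≠ 0 := by
  rw [← Matrix.det_transpose, Matrix.det_apply] at hM
  obtain ⟨σ, -, hσ⟩ := Finset.exists_ne_zero_of_sum_ne_zero hM
  refine ⟨σ, fun i hi => hσ ?_⟩
  rw [Finset.prod_eq_zero (Finset.mem_univ i) hi, smul_zero]

/-- If a matrix has only as many nonzero entries as rows, and a permutation picks a nonzero
entry from each row, then all other entries vanish. -/
theorem Matrix.apply_eq_zero_of_ncard_support {n R : Type*} [Fintype n] [Zero R]
    {M : Matrix n n R} (hcard : {p : n × n | M p.1 p.2 ≠ 0}.ncard = Fintype.card n)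
    {σ : Equiv.Perm n} (hσ : ∀ i, M i (σ i) ≠ 0) {i j : n} (hij : σ i ≠ j) :
    M i j = 0 := by
  have hsub : Set.range (fun i => (i, σ i)) ⊆ {p : n × n | M p.1 p.2 ≠ 0} := by
    rintro _ ⟨i, rfl⟩
    exact hσ i
  have hinj : Function.Injective (fun i => (i, σ i)) := fun a b h => congrArg Prod.fst h
  have heq := Set.eq_of_subset_of_ncard_le hsub (by
    rw [hcard, ← Set.image_univ, Set.ncard_image_of_injective _ hinj, Set.ncard_univ,
      Nat.card_eq_fintype_card]) (Set.toFinite _)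
  by_contra h
  have hmem : (i, j) ∈ Set.range (fun i => (i, σ i)) := heq ▸ h
  obtain ⟨k, hk⟩ := hmem
  obtain ⟨rfl, rfl⟩ := Prod.mk.inj hk
  exact hij rfl

theorem Equiv.Perm.fin_three_cases (σ : Equiv.Perm (Fin 3)) :
    (∀ i, σ i = i) ∨ ∃ i j k : Fin 3, i ≠ j ∧ i ≠ k ∧ j ≠ k ∧ (∀ l, l = i ∨ l = j ∨ l = k) ∧
      σ i = j ∧ (σ j = i ∧ σ k = k ∨ σ j = k ∧ σ k = i) := by
  revert σ
  decide

theorem exists_ne_zero_mul_pow_eq_one {K : Type*} [Field K] {n : ℕ} (hn : n ≠ 0)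
    (h : ∀ x : K, ∃ y, y ^ n = x) {c : K} (hc : c ≠ 0) : ∃ y : K, y ≠ 0 ∧ c * y ^ n = 1 := by
  obtain ⟨y, hy⟩ := h c⁻¹
  refine ⟨y, ?_, by rw [hy, mul_inv_cancel₀ hc]⟩
  rintro rfl
  rw [zero_pow hn] at hy
  exact inv_ne_zero hc hy.symm

theorem exists_ne_zero_eq_mul_sq_perm {K : Type*} [Field K]
    (h3 : ∀ x : K, ∃ y, y ^ 3 = x) (h7 : ∀ x : K, ∃ y, y ^ 7 = x)
    (σ : Equiv.Perm (Fin 3)) (a : Fin 3 → K) (ha : ∀ i, a i ≠ 0) :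
    ∃ d : Fin 3 → K, (∀ i, d i ≠ 0) ∧ ∀ i, a i * d (σ i) ^ 2 = d i := by
  rcases σ.fin_three_cases with h | ⟨i, j, k, hij, hik, hjk, hall, hi, ⟨hj, hk⟩ | ⟨hj, hk⟩⟩
  · refine ⟨fun i => (a i)⁻¹, fun i => inv_ne_zero (ha i), fun i => ?_⟩
    have := ha i
    rw [h i]
    field_simp
  · obtain ⟨y, hy0, hy⟩ := exists_ne_zero_mul_pow_eq_one (by norm_num) h3
      (mul_ne_zero (ha i) (pow_ne_zero 2 (ha j)))
    have hai := ha i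
    have haj := ha j
    have hak := ha k
    refine ⟨fun l => if l = i then y else if l = j then a j * y ^ 2 else (a k)⁻¹, ?_, ?_⟩
    · intro l
      dsimp only
      split_ifs
      exacts [hy0, mul_ne_zero haj (pow_ne_zero 2 hy0), inv_ne_zero hak]
    · intro l
      rcases hall l with rfl | rfl | rfl
      · simp only [hi, hij.symm, if_true, if_false]
        linear_combination y * hy
      · simp only [hj, hij.symm, if_true, if_false]
      · simp only [hk, hik.symm, hjk.symm, if_false]
        field_simp
  · obtain ⟨y, hy0, hy⟩ := exists_ne_zero_mul_pow_eq_one (by norm_num) h7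
      (mul_ne_zero (mul_ne_zero (ha i) (pow_ne_zero 2 (ha j))) (pow_ne_zero 4 (ha k)))
    have haj := ha j
    have hak := ha k
    refine ⟨fun l => if l = i then y else if l = j then a j * (a k * y ^ 2) ^ 2
      else a k * y ^ 2, ?_, ?_⟩
    · intro l
      have hk0 := mul_ne_zero hak (pow_ne_zero 2 hy0)
      dsimp only
      split_ifs
      exacts [hy0, mul_ne_zero haj (pow_ne_zero 2 hk0), hk0]
    · intro l
      rcases hall l with rfl | rfl | rfl
      · simp only [hi, hij.symm, if_true, if_false]
        linear_combination y * hy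
      · simp only [hj, hij.symm, hik.symm, hjk.symm, if_true, if_false]
      · simp only [hk, hik.symm, hjk.symm, if_true, if_false]


/-- Let `K` be a field in which every element has a cube root and a
seventh root.  If `M` is an invertible `3 × 3` matrix over `K` with exactly three nonzero
entries, then there is an invertible diagonal matrix `D` such that `D⁻¹ * M * D^{(2)}` is
a permutation matrix. -/
theorem diagonal_reduction_of_three_entry_matrix
    {K : Type*} [Field K]
    (h3 : ∀ x : K, ∃ y, y ^ 3 = x) (h7 : ∀ x : K, ∃ y, y ^ 7 = x)
    (M : Matrix (Fin 3) (Fin 3) K) (hMdet : M.det ≠ 0)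
    (hM3 : {p : Fin 3 × Fin 3 | M p.1 p.2 ≠ 0}.ncard = 3) :
    ∃ d : Fin 3 → K, (∀ i, d i ≠ 0) ∧
      ∃ σ : Equiv.Perm (Fin 3),
        (Matrix.diagonal d)⁻¹ * M * (Matrix.diagonal d).map (fun x => x ^ 2) =
          Matrix.of (fun i j => if σ i = j then (1 : K) else 0) := by
  obtain ⟨σ, hσ⟩ := Matrix.exists_perm_forall_apply_ne_zero hMdet
  obtain ⟨d, hd, hrel⟩ := exists_ne_zero_eq_mul_sq_perm h3 h7 σ (fun i => M i (σ i)) hσ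
  refine ⟨d, hd, σ, ?_⟩
  have hinv : (Matrix.diagonal d)⁻¹ = Matrix.diagonal (fun i => (d i)⁻¹) := by
    refine Matrix.inv_eq_right_inv ?_
    rw [Matrix.diagonal_mul_diagonal, ← Matrix.diagonal_one]
    congr 1
    funext i
    exact mul_inv_cancel₀ (hd i)
  rw [hinv, Matrix.diagonal_map (by simp)]
  ext i j
  rw [Matrix.mul_diagonal, Matrix.diagonal_mul, Matrix.of_apply]
  split_ifs with h
  · subst h
    rw [mul_assoc, hrel i, inv_mul_cancel₀ (hd i)]
  · rw [Matrix.apply_eq_zero_of_ncard_support (by simpa using hM3) hσ h, mul_zero, zero_mul]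
end

section
/- Let K be a field of characteristic different from 2 in which every element has an n-th root for n = 2, 3, 7. The three evolution algebras on K³ whose structure matrices (relative to the standard basis) are the identity matrix id₃, the matrix with rows (0,1,0), (1,0,0), (0,0,1), and the matrix with rows (0,1,0), (0,0,1), (1,0,0) are pairwise non-isomorphic as K-algebras. -/
/-- The evolution algebra product on `K³` attached to a `3 × 3` matrix `M`:
`(x · y)_k = ∑ i, M k i * x i * y i`. -/
def evoMul {K : Type*} [Field K] (M : Matrix (Fin 3) (Fin 3) K) (x y : Fin 3 → K) :
    Fin 3 → K :=
  fun k => ∑ i, M k i * x i * y i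

/-- Isomorphism of the evolution algebras `E(M)` and `E(N)` on `K³`: a bijective
`K`-linear map preserving the products. -/
def EvoIso {K : Type*} [Field K] (M N : Matrix (Fin 3) (Fin 3) K) : Prop :=
  ∃ φ : (Fin 3 → K) ≃ₗ[K] (Fin 3 → K),
    ∀ x y, φ (evoMul M x y) = evoMul N (φ x) (φ y)

/-- The algebra `E(1)` is unital, so any algebra isomorphic to it is unital. -/
theorem EvoIso.exists_right_unit {K : Type*} [Field K] {N : Matrix (Fin 3) (Fin 3) K}
    (h : EvoIso 1 N) : ∃ u, ∀ x, evoMul N x u = x := by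
  obtain ⟨φ, hφ⟩ := h
  refine ⟨φ 1, fun x => ?_⟩
  have hone : evoMul 1 (φ.symm x) 1 = φ.symm x := by
    ext k
    simp [evoMul, Matrix.one_apply]
  simpa [hone] using (hφ (φ.symm x) 1).symm

/-- If the product of `e₀` with every element has zero `0`-th coordinate, then `E(N)` has no
unit and is not isomorphic to `E(1)`. -/
theorem not_evoIso_one_of_apply_zero_zero {K : Type*} [Field K]
    {N : Matrix (Fin 3) (Fin 3) K} (hN : N 0 0 = 0) : ¬ EvoIso 1 N := by
  intro h
  obtain ⟨u, hu⟩ := h.exists_right_unit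
  simpa [evoMul, Fin.sum_univ_three, hN] using congrFun (hu (Pi.single 0 1)) 0

/-- In the evolution algebra of the 3-cycle, a nonzero idempotent annihilates only `0`. -/
theorem eq_zero_of_evoMul_cycle_idempotent {K : Type*} [Field K] {a b : Fin 3 → K}
    (ha : a ≠ 0) (haa : evoMul !![0,1,0; 0,0,1; 1,0,0] a a = a)
    (hab : evoMul !![0,1,0; 0,0,1; 1,0,0] a b = 0) : b = 0 := by
  simp only [funext_iff, Fin.forall_fin_succ, evoMul, Fin.sum_univ_three] at haa hab
  simp at haa hab
  obtain ⟨h0, h1, h2⟩ := haa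
  have hne : a 0 ≠ 0 ∧ a 1 ≠ 0 ∧ a 2 ≠ 0 := by
    by_contra hzero
    apply ha
    ext i
    fin_cases i <;> simp <;> grind
  ext i
  fin_cases i <;> simp <;> grind

/-- Over a field of characteristic `≠ 2` with roots of orders `2, 3, 7`,
the three evolution algebras on `K³` with structure matrices `id₃`,
`!![0,1,0; 1,0,0; 0,0,1]` and `!![0,1,0; 0,0,1; 1,0,0]` are pairwise non-isomorphic. -/
theorem three_entry_evolution_algebras_pairwise_nonisomorphic
    {K : Type*} [Field K]
    (hchar : ringChar K ≠ 2)
    (hr2 : ∀ x : K, ∃ y, y ^ 2 = x) (hr3 : ∀ x : K, ∃ y, y ^ 3 = x)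
    (hr7 : ∀ x : K, ∃ y, y ^ 7 = x) :
    ¬ EvoIso (1 : Matrix (Fin 3) (Fin 3) K) !![0,1,0; 1,0,0; 0,0,1] ∧
    ¬ EvoIso (1 : Matrix (Fin 3) (Fin 3) K) !![0,1,0; 0,0,1; 1,0,0] ∧
    ¬ EvoIso (!![0,1,0; 1,0,0; 0,0,1] : Matrix (Fin 3) (Fin 3) K)
        !![0,1,0; 0,0,1; 1,0,0] := by
  refine ⟨not_evoIso_one_of_apply_zero_zero (by simp),
    not_evoIso_one_of_apply_zero_zero (by simp), ?_⟩
  rintro ⟨φ, hφ⟩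
  have hidem : evoMul (!![0,1,0; 1,0,0; 0,0,1] : Matrix (Fin 3) (Fin 3) K)
      (Pi.single 2 1) (Pi.single 2 1) = Pi.single 2 1 := by
    ext k
    fin_cases k <;> simp [evoMul, Fin.sum_univ_three]
  have hann : evoMul (!![0,1,0; 1,0,0; 0,0,1] : Matrix (Fin 3) (Fin 3) K)
      (Pi.single 2 1) (Pi.single 0 1) = 0 := by
    ext k
    fin_cases k <;> simp [evoMul, Fin.sum_univ_three]
  have hzero : φ (Pi.single 0 1) = 0 :=
    eq_zero_of_evoMul_cycle_idempotent (a := φ (Pi.single 2 1)) (by simp)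
      (by rw [← hφ, hidem]) (by rw [← hφ, hann, map_zero])
  simp at hzero
end

section
/- Let K be a field of characteristic different from 2 in which every element has an n-th root for n = 2, 3, 7. The seven evolution algebras on K³ whose structure matrices (relative to the standard basis, given by rows) are (1,−1,1),(1,−1,1),(0,0,0); (1,−1,0),(1,−1,0),(0,0,0); (1,1,1),(0,0,0),(0,0,0); (1,0,1),(0,0,0),(0,0,0); (1,0,0),(0,0,0),(0,0,0); (0,1,1),(0,0,0),(0,0,0); (0,0,1),(0,0,0),(0,0,0) are pairwise non-isomorphic as K-algebras. -/
/-- The annihilator of `E(M)` is trivial. -/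
def TrivialAnnihilator {K : Type*} [Field K] (M : Matrix (Fin 3) (Fin 3) K) : Prop :=
  ∀ x, (∀ y, evoMul M x y = 0) → x = 0

/-- Every element of `E(M)` with zero square lies in the annihilator. -/
def SquareZeroAnnihilates {K : Type*} [Field K] (M : Matrix (Fin 3) (Fin 3) K) : Prop :=
  ∀ x, evoMul M x x = 0 → ∀ y, evoMul M x y = 0

/-- The square `A²` of `A = E(M)` satisfies `A² A² = 0`. -/
def SquareMulSquareZero {K : Type*} [Field K] (M : Matrix (Fin 3) (Fin 3) K) : Prop :=
  ∀ x y z w, evoMul M (evoMul M x y) (evoMul M z w) = 0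

/-- The square `A²` of `A = E(M)` satisfies `A² A = 0`. -/
def SquareMulZero {K : Type*} [Field K] (M : Matrix (Fin 3) (Fin 3) K) : Prop :=
  ∀ x y z, evoMul M (evoMul M x y) z = 0

/-- The four isomorphism invariants of `E(M)` which separate the algebras with
one-dimensional square. -/
def evoInvariants {K : Type*} [Field K] (M : Matrix (Fin 3) (Fin 3) K) :
    Prop × Prop × Prop × Prop :=
  (TrivialAnnihilator M, SquareZeroAnnihilates M, SquareMulSquareZero M, SquareMulZero M)

theorem EvoIso.evoInvariants_eq {K : Type*} [Field K] {M N : Matrix (Fin 3) (Fin 3) K}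
    (h : EvoIso M N) : evoInvariants M = evoInvariants N := by
  obtain ⟨φ, hφ⟩ := h
  have hzero : ∀ x y, evoMul M x y = 0 ↔ evoMul N (φ x) (φ y) = 0 := fun x y => by
    rw [← hφ, LinearEquiv.map_eq_zero_iff]
  simp only [evoInvariants, Prod.mk.injEq, eq_iff_iff]
  refine ⟨φ.toEquiv.forall_congr fun x => ?_, φ.toEquiv.forall_congr fun x => ?_,
    φ.toEquiv.forall_congr fun x => φ.toEquiv.forall_congr fun y =>
      φ.toEquiv.forall_congr fun z => φ.toEquiv.forall_congr fun w => ?_,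
    φ.toEquiv.forall_congr fun x => φ.toEquiv.forall_congr fun y =>
      φ.toEquiv.forall_congr fun z => ?_⟩
  · exact imp_congr (φ.toEquiv.forall_congr fun y => hzero x y) φ.map_eq_zero_iff.symm
  · exact imp_congr (hzero x x) (φ.toEquiv.forall_congr fun y => hzero x y)
  · rw [hzero, hφ, hφ]; rfl
  · rw [hzero, hφ]; rfl

section Invariants

variable {K : Type*} [Field K]

theorem evoInvariants_hyperbolic_plane_nondegenerate :
    evoInvariants (!![1,-1,1; 1,-1,1; 0,0,0] : Matrix (Fin 3) (Fin 3) K) =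
      (True, False, True, False) := by
  simp only [evoInvariants, Prod.mk.injEq, eq_iff_iff, iff_true, iff_false]
  refine ⟨?_, ?_, ?_, ?_⟩
  · intro x h
    have h0 := congrFun (h ![1, 0, 0]) 0
    have h1 := congrFun (h ![0, 1, 0]) 0
    have h2 := congrFun (h ![0, 0, 1]) 0
    simp [evoMul, Fin.sum_univ_succ] at h0 h1 h2
    simp [funext_iff, Fin.forall_fin_succ, h0, h1, h2]
  · intro h
    have := congrFun (h ![1, 1, 0] (by
      simp [evoMul, funext_iff, Fin.forall_fin_succ, Fin.sum_univ_succ]) ![1, 0, 0]) 0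
    simp [evoMul, Fin.sum_univ_succ] at this
  · intro x y z w
    simp [evoMul, funext_iff, Fin.forall_fin_succ, Fin.sum_univ_succ]
    ring
  · intro h
    have := congrFun (h ![1, 0, 0] ![1, 0, 0] ![1, 0, 0]) 0
    simp [evoMul, Fin.sum_univ_succ] at this

theorem evoInvariants_hyperbolic_plane_degenerate :
    evoInvariants (!![1,-1,0; 1,-1,0; 0,0,0] : Matrix (Fin 3) (Fin 3) K) =
      (False, False, True, False) := by
  simp only [evoInvariants, Prod.mk.injEq, eq_iff_iff, iff_true, iff_false]
  refine ⟨?_, ?_, ?_, ?_⟩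
  · intro h
    have := h ![0, 0, 1] (fun y => by
      simp [evoMul, funext_iff, Fin.forall_fin_succ, Fin.sum_univ_succ])
    simp at this
  · intro h
    have := congrFun (h ![1, 1, 0] (by
      simp [evoMul, funext_iff, Fin.forall_fin_succ, Fin.sum_univ_succ]) ![1, 0, 0]) 0
    simp [evoMul, Fin.sum_univ_succ] at this
  · intro x y z w
    simp [evoMul, funext_iff, Fin.forall_fin_succ, Fin.sum_univ_succ]
    ring
  · intro h
    have := congrFun (h ![1, 0, 0] ![1, 0, 0] ![1, 0, 0]) 0
    simp [evoMul, Fin.sum_univ_succ] at this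

theorem evoInvariants_idempotent_rank_three {i : K} (hi : i ^ 2 = -1) :
    evoInvariants (!![1,1,1; 0,0,0; 0,0,0] : Matrix (Fin 3) (Fin 3) K) =
      (True, False, False, False) := by
  simp only [evoInvariants, Prod.mk.injEq, eq_iff_iff, iff_true, iff_false]
  refine ⟨?_, ?_, ?_, ?_⟩
  · intro x h
    have h0 := congrFun (h ![1, 0, 0]) 0
    have h1 := congrFun (h ![0, 1, 0]) 0
    have h2 := congrFun (h ![0, 0, 1]) 0
    simp [evoMul, Fin.sum_univ_succ] at h0 h1 h2
    simp [funext_iff, Fin.forall_fin_succ, h0, h1, h2]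
  · intro h
    have := congrFun (h ![1, i, 0] (by
      simp [evoMul, funext_iff, Fin.forall_fin_succ, Fin.sum_univ_succ]
      linear_combination hi) ![1, 0, 0]) 0
    simp [evoMul, Fin.sum_univ_succ] at this
  · intro h
    have := congrFun (h ![1, 0, 0] ![1, 0, 0] ![1, 0, 0] ![1, 0, 0]) 0
    simp [evoMul, Fin.sum_univ_succ] at this
  · intro h
    have := congrFun (h ![1, 0, 0] ![1, 0, 0] ![1, 0, 0]) 0
    simp [evoMul, Fin.sum_univ_succ] at this

theorem evoInvariants_idempotent_rank_two {i : K} (hi : i ^ 2 = -1) :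
    evoInvariants (!![1,0,1; 0,0,0; 0,0,0] : Matrix (Fin 3) (Fin 3) K) =
      (False, False, False, False) := by
  simp only [evoInvariants, Prod.mk.injEq, eq_iff_iff, iff_false]
  refine ⟨?_, ?_, ?_, ?_⟩
  · intro h
    have := h ![0, 1, 0] (fun y => by
      simp [evoMul, funext_iff, Fin.forall_fin_succ, Fin.sum_univ_succ])
    simp at this
  · intro h
    have := congrFun (h ![1, 0, i] (by
      simp [evoMul, funext_iff, Fin.forall_fin_succ, Fin.sum_univ_succ]
      linear_combination hi) ![1, 0, 0]) 0
    simp [evoMul, Fin.sum_univ_succ] at this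
  · intro h
    have := congrFun (h ![1, 0, 0] ![1, 0, 0] ![1, 0, 0] ![1, 0, 0]) 0
    simp [evoMul, Fin.sum_univ_succ] at this
  · intro h
    have := congrFun (h ![1, 0, 0] ![1, 0, 0] ![1, 0, 0]) 0
    simp [evoMul, Fin.sum_univ_succ] at this

theorem evoInvariants_idempotent_rank_one :
    evoInvariants (!![1,0,0; 0,0,0; 0,0,0] : Matrix (Fin 3) (Fin 3) K) =
      (False, True, False, False) := by
  simp only [evoInvariants, Prod.mk.injEq, eq_iff_iff, iff_true, iff_false]
  refine ⟨?_, ?_, ?_, ?_⟩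
  · intro h
    have := h ![0, 1, 0] (fun y => by
      simp [evoMul, funext_iff, Fin.forall_fin_succ, Fin.sum_univ_succ])
    simp at this
  · intro x h y
    have h0 := congrFun h 0
    simp [evoMul, Fin.sum_univ_succ] at h0
    simp [evoMul, funext_iff, Fin.forall_fin_succ, Fin.sum_univ_succ, h0]
  · intro h
    have := congrFun (h ![1, 0, 0] ![1, 0, 0] ![1, 0, 0] ![1, 0, 0]) 0
    simp [evoMul, Fin.sum_univ_succ] at this
  · intro h
    have := congrFun (h ![1, 0, 0] ![1, 0, 0] ![1, 0, 0]) 0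
    simp [evoMul, Fin.sum_univ_succ] at this

theorem evoInvariants_nilpotent_rank_two {i : K} (hi : i ^ 2 = -1) :
    evoInvariants (!![0,1,1; 0,0,0; 0,0,0] : Matrix (Fin 3) (Fin 3) K) =
      (False, False, True, True) := by
  simp only [evoInvariants, Prod.mk.injEq, eq_iff_iff, iff_true, iff_false]
  refine ⟨?_, ?_, ?_, ?_⟩
  · intro h
    have := h ![1, 0, 0] (fun y => by
      simp [evoMul, funext_iff, Fin.forall_fin_succ, Fin.sum_univ_succ])
    simp at this
  · intro h
    have := congrFun (h ![0, 1, i] (by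
      simp [evoMul, funext_iff, Fin.forall_fin_succ, Fin.sum_univ_succ]
      linear_combination hi) ![0, 1, 0]) 0
    simp [evoMul, Fin.sum_univ_succ] at this
  · intro x y z w
    simp [evoMul, funext_iff, Fin.forall_fin_succ, Fin.sum_univ_succ]
  · intro x y z
    simp [evoMul, funext_iff, Fin.forall_fin_succ, Fin.sum_univ_succ]

theorem evoInvariants_nilpotent_rank_one :
    evoInvariants (!![0,0,1; 0,0,0; 0,0,0] : Matrix (Fin 3) (Fin 3) K) =
      (False, True, True, True) := by
  simp only [evoInvariants, Prod.mk.injEq, eq_iff_iff, iff_true, iff_false]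
  refine ⟨?_, ?_, ?_, ?_⟩
  · intro h
    have := h ![1, 0, 0] (fun y => by
      simp [evoMul, funext_iff, Fin.forall_fin_succ, Fin.sum_univ_succ])
    simp at this
  · intro x h y
    have h0 := congrFun h 0
    simp [evoMul, Fin.sum_univ_succ] at h0
    simp [evoMul, funext_iff, Fin.forall_fin_succ, Fin.sum_univ_succ, h0]
  · intro x y z w
    simp [evoMul, funext_iff, Fin.forall_fin_succ, Fin.sum_univ_succ]
  · intro x y z
    simp [evoMul, funext_iff, Fin.forall_fin_succ, Fin.sum_univ_succ]

end Invariants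

/-- Over a field of characteristic `≠ 2` with roots of orders `2, 3, 7`,
the seven evolution algebras on `K³` listed in Table 1 of the paper (the case
`dim A² = 1`) are pairwise non-isomorphic. -/
theorem dim_one_square_evolution_algebras_pairwise_nonisomorphic
    {K : Type*} [Field K]
    (hchar : ringChar K ≠ 2)
    (hr2 : ∀ x : K, ∃ y, y ^ 2 = x) (hr3 : ∀ x : K, ∃ y, y ^ 3 = x)
    (hr7 : ∀ x : K, ∃ y, y ^ 7 = x) :
    ∀ M ∈ ([!![1,-1,1; 1,-1,1; 0,0,0],
            !![1,-1,0; 1,-1,0; 0,0,0],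
            !![1,1,1; 0,0,0; 0,0,0],
            !![1,0,1; 0,0,0; 0,0,0],
            !![1,0,0; 0,0,0; 0,0,0],
            !![0,1,1; 0,0,0; 0,0,0],
            !![0,0,1; 0,0,0; 0,0,0]] : List (Matrix (Fin 3) (Fin 3) K)),
    ∀ N ∈ ([!![1,-1,1; 1,-1,1; 0,0,0],
            !![1,-1,0; 1,-1,0; 0,0,0],
            !![1,1,1; 0,0,0; 0,0,0],
            !![1,0,1; 0,0,0; 0,0,0],
            !![1,0,0; 0,0,0; 0,0,0],
            !![0,1,1; 0,0,0; 0,0,0],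
            !![0,0,1; 0,0,0; 0,0,0]] : List (Matrix (Fin 3) (Fin 3) K)),
    M ≠ N → ¬ EvoIso M N := by
  obtain ⟨i, hi⟩ := hr2 (-1)
  intro M hM N hN hne hiso
  have h := hiso.evoInvariants_eq
  simp only [List.mem_cons, List.not_mem_nil, or_false] at hM hN
  rcases hM with rfl | rfl | rfl | rfl | rfl | rfl | rfl <;>
    rcases hN with rfl | rfl | rfl | rfl | rfl | rfl | rfl <;>
    first
    | exact hne rfl
    | simp [evoInvariants_hyperbolic_plane_nondegenerate,
        evoInvariants_hyperbolic_plane_degenerate,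
        evoInvariants_idempotent_rank_three hi, evoInvariants_idempotent_rank_two hi,
        evoInvariants_idempotent_rank_one, evoInvariants_nilpotent_rank_two hi,
        evoInvariants_nilpotent_rank_one] at h
end

section
/- Let K be a field of characteristic different from 2 and let α ∈ K with α ≠ 0 and α² + 1 ≠ 0. Then the evolution algebra on K³ with structure matrix having rows (1,0,0), (0,1,1), (0,α,α) is isomorphic as a K-algebra to the evolution algebra on K³ with structure matrix having rows (1,0,0), (0,1,1), (0,1,1). -/
/-- The linear automorphism of `K³` that fixes the first coordinate and acts on the last two
as multiplication by `a + b i`, with `a ^ 2 + b ^ 2 ≠ 0`. -/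
def planeSimilarity {K : Type*} [Field K] (a b : K) (h : a ^ 2 + b ^ 2 ≠ 0) :
    (Fin 3 → K) ≃ₗ[K] (Fin 3 → K) where
  toFun x := ![x 0, a * x 1 - b * x 2, b * x 1 + a * x 2]
  map_add' x y := by
    ext i
    fin_cases i <;> simp <;> ring
  map_smul' r x := by
    ext i
    fin_cases i <;> simp <;> ring
  invFun y := ![y 0, (a * y 1 + b * y 2) / (a ^ 2 + b ^ 2), (a * y 2 - b * y 1) / (a ^ 2 + b ^ 2)]
  left_inv x := by
    ext i
    fin_cases i <;> simp <;> field_simp <;> ring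
  right_inv y := by
    ext i
    fin_cases i <;> simp <;> field_simp <;> ring

theorem planeSimilarity_apply {K : Type*} [Field K] (a b : K) (h : a ^ 2 + b ^ 2 ≠ 0)
    (x : Fin 3 → K) :
    planeSimilarity a b h x = ![x 0, a * x 1 - b * x 2, b * x 1 + a * x 2] :=
  rfl

/-- Over a field of characteristic `≠ 2`, if `α ≠ 0` and `α² + 1 ≠ 0`,
the evolution algebra with structure matrix `!![1,0,0; 0,1,1; 0,α,α]` is isomorphic to the
one with structure matrix `!![1,0,0; 0,1,1; 0,1,1]`. -/
theorem evoIso_case_alpha_one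
    {K : Type*} [Field K] (hchar : ringChar K ≠ 2)
    (α : K) (hα : α ≠ 0) (hα1 : α ^ 2 + 1 ≠ 0) :
    EvoIso !![1,0,0; 0,1,1; 0,α,α] !![(1:K),0,0; 0,1,1; 0,1,1] := by
  have h2 : (2 : K) ≠ 0 := Ring.two_ne_zero hchar
  have h : ((1 + α) / 2) ^ 2 + ((1 - α) / 2) ^ 2 ≠ 0 := by
    have e : ((1 + α) / 2) ^ 2 + ((1 - α) / 2) ^ 2 = (α ^ 2 + 1) / 2 := by
      field_simp
      ring
    rw [e]
    exact div_ne_zero hα1 h2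
  refine ⟨planeSimilarity _ _ h, fun x y => ?_⟩
  ext i
  fin_cases i <;> simp [planeSimilarity_apply, evoMul, Fin.sum_univ_three] <;> field_simp <;> ring
end

section
/- Let K be a field of characteristic different from 2 in which every element has a cube root, and let α ∈ K with α ≠ 0 and α² + 1 ≠ 0. Then the evolution algebra on K³ with structure matrix having rows (0,1,1), (1,0,0), (α,0,0) is isomorphic as a K-algebra to the evolution algebra on K³ with structure matrix having rows (0,1,1), (1,0,0), (1,0,0). -/
/-- The linear automorphism of `K³` which scales the first coordinate by `c` and acts on the other
two as multiplication by `a + b i`, where `a² + b² = c`. -/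
def scaleSimilitude {K : Type*} [Field K] (a b c : K) (hc : c ≠ 0) (h : a ^ 2 + b ^ 2 = c) :
    (Fin 3 → K) ≃ₗ[K] (Fin 3 → K) where
  toFun x := ![c * x 0, a * x 1 - b * x 2, b * x 1 + a * x 2]
  invFun x := ![c⁻¹ * x 0, c⁻¹ * (a * x 1 + b * x 2), c⁻¹ * (a * x 2 - b * x 1)]
  map_add' x y := by ext k; fin_cases k <;> simp <;> ring
  map_smul' r x := by ext k; fin_cases k <;> simp <;> ring
  left_inv x := by
    ext k
    fin_cases k <;> simp <;> field_simp <;> rw [← h] <;> ring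
  right_inv x := by
    ext k
    fin_cases k <;> simp <;> field_simp <;> rw [← h] <;> ring

/-- Over a field of characteristic `≠ 2` in which every element has a
cube root, if `α ≠ 0` and `α² + 1 ≠ 0`, the evolution algebra with structure matrix
`!![0,1,1; 1,0,0; α,0,0]` is isomorphic to the one with structure matrix
`!![0,1,1; 1,0,0; 1,0,0]`. -/
theorem evoIso_case_alpha_one_cube
    {K : Type*} [Field K] (hchar : ringChar K ≠ 2)
    (hr3 : ∀ x : K, ∃ y, y ^ 3 = x)
    (α : K) (hα : α ≠ 0) (hα1 : α ^ 2 + 1 ≠ 0) :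
    EvoIso !![0,1,1; 1,0,0; α,0,0] !![(0:K),1,1; 1,0,0; 1,0,0] := by
  have h2 : (2 : K) ≠ 0 := Ring.two_ne_zero hchar
  obtain ⟨c, hc⟩ := hr3 ((α ^ 2 + 1) / 2)
  have hc0 : c ≠ 0 := by
    rintro rfl
    exact div_ne_zero hα1 h2 (by simpa using hc.symm)
  have hc3 : 2 * c ^ 3 = α ^ 2 + 1 := by rw [hc]; field_simp
  obtain ⟨a, ha⟩ : ∃ a, a * (α ^ 2 + 1) = c ^ 2 * (1 + α) := ⟨_, div_mul_cancel₀ _ hα1⟩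
  obtain ⟨b, hb⟩ : ∃ b, b * (α ^ 2 + 1) = c ^ 2 * (1 - α) := ⟨_, div_mul_cancel₀ _ hα1⟩
  have hre : a - b * α = c ^ 2 :=
    mul_right_cancel₀ hα1 (by linear_combination ha - α * hb)
  have him : b + a * α = c ^ 2 :=
    mul_right_cancel₀ hα1 (by linear_combination hb + α * ha)
  have hab : a ^ 2 + b ^ 2 = c :=
    mul_right_cancel₀ hα1 (by
      linear_combination (a - b * α + c ^ 2) * hre + (b + a * α + c ^ 2) * him + c * hc3)
  refine ⟨scaleSimilitude a b c hc0 hab, fun x y => ?_⟩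
  ext k
  fin_cases k <;> simp [scaleSimilitude, evoMul, Fin.sum_univ_three]
  · linear_combination (-(x 1 * y 1 + x 2 * y 2)) * hab
  · linear_combination x 0 * y 0 * hre
  · linear_combination x 0 * y 0 * him
end

section
/- Let K be a field containing an element i with i² = −1, and let c ∈ K with c ≠ 0. Then the evolution algebra on K³ with structure matrix having rows (0,0,0), (0,1,1), (1,0,c) is isomorphic as a K-algebra to the evolution algebra on K³ with structure matrix having rows (0,0,0), (0,1,1), (1,0,−c). -/
/-- If `K` contains an element `i` with `i² = −1` and `c ≠ 0`, the
evolution algebra with structure matrix `!![0,0,0; 0,1,1; 1,0,c]` is isomorphic to the one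
with structure matrix `!![0,0,0; 0,1,1; 1,0,−c]`. -/
theorem evoIso_case_c_neg_c
    {K : Type*} [Field K] (i : K) (hi : i ^ 2 = -1)
    (c : K) (hc : c ≠ 0) :
    EvoIso !![0,0,0; 0,1,1; 1,0,c] !![(0:K),0,0; 0,1,1; 1,0,-c] := by
  have hi0 : i ≠ 0 := by
    rintro rfl
    simp at hi
  refine ⟨LinearEquiv.piCongrRight fun j => LinearEquiv.smulOfNeZero K K (![i, 1, -1] j) ?_, ?_⟩
  · fin_cases j <;> simp [hi0]
  · intro x y
    ext k
    fin_cases k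
    · simp [evoMul, Fin.sum_univ_three]
    · simp [evoMul, Fin.sum_univ_three]
    · simp [evoMul, Fin.sum_univ_three]
      linear_combination (-(x 0 * y 0)) * hi
end

section
/- Let K be a field and let c ∈ K with c ≠ 0 such that c has a square root in K. Then the evolution algebra on K³ with structure matrix having rows (0,0,0), (1,0,c), (1,1,0) is isomorphic as a K-algebra to the evolution algebra on K³ with structure matrix having rows (0,0,0), (1,0,1/c), (1,1,0). -/
/-- If `c ≠ 0` has a square root in `K`, the evolution algebra with
structure matrix `!![0,0,0; 1,0,c; 1,1,0]` is isomorphic to the one with structure matrix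
`!![0,0,0; 1,0,1/c; 1,1,0]`. -/
theorem evoIso_case_c_inv_c
    {K : Type*} [Field K] (c : K) (hc : c ≠ 0) (hsq : ∃ s : K, s ^ 2 = c) :
    EvoIso !![0,0,0; 1,0,c; 1,1,0] !![(0:K),0,0; 1,0,c⁻¹; 1,1,0] := by
  obtain ⟨s, rfl⟩ := hsq
  have hs : s ≠ 0 := by
    rintro rfl
    simp at hc
  refine ⟨
    { toFun := fun x => ![s * x 0, s ^ 2 * x 2, s ^ 2 * x 1]
      invFun := fun x => ![s⁻¹ * x 0, (s ^ 2)⁻¹ * x 2, (s ^ 2)⁻¹ * x 1]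
      map_add' := fun x y => by
        ext k
        fin_cases k <;> simp [mul_add]
      map_smul' := fun r x => by
        ext k
        fin_cases k <;> simp [mul_left_comm]
      left_inv := fun x => by
        ext k
        fin_cases k <;> simp [hs]
      right_inv := fun x => by
        ext k
        fin_cases k <;> simp [hs] }, fun x y => ?_⟩
  ext k
  fin_cases k <;> simp [evoMul, Fin.sum_univ_three] <;> field_simp
end
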